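/- arXiv:2009.07801 — 2 statements merged into one kernel-verified Lean document; each statement's English description precedes it below -/
import Mathlib

section
/- For every s ≥ 1 and β > 0, the maximum over all ŷ ∈ {0,1}^s of the Euclidean norm ‖b_ŷ‖₂ satisfies max_{ŷ ∈ {0,1}^s} ‖b_ŷ‖₂ ≤ ((1+β²)/(2β)) · √(ln s + 1). -/
open Finset

/-- Number of ones in a labeling `y ∈ {0,1}^s`. -/
def cnt {s : ℕ} (y : Fin s → Bool) : ℕ :=
  (Finset.univ.filter (fun j => y j = true)).card

/-- Real-valued indicator of a boolean. -/
noncomputable def indR (b : Bool) : ℝ := if b then 1 else 0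

/-- The F_β measure of a predicted labeling `yh` against a true labeling `y`,
with the convention `F_β(0,0) = 1`. -/
noncomputable def Fb (s : ℕ) (β : ℝ) (y yh : Fin s → Bool) : ℝ :=
  if cnt y = 0 ∧ cnt yh = 0 then 1
  else ((1 + β ^ 2) * ∑ j, indR (y j) * indR (yh j)) /
    (β ^ 2 * (cnt y : ℝ) + (cnt yh : ℝ))

/-- Index set for the `s² + 1` coordinates: `none` is the coordinate `0`,
and `some (j,k)` is the coordinate `(j,k) ∈ [s] × [s]` (with `k` encoding `k+1`). -/
abbrev Coord (s : ℕ) := Option (Fin s × Fin s)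

/-- The vector `a_y ∈ {0,1}^{s²+1}`. -/
noncomputable def aVec (s : ℕ) (y : Fin s → Bool) : Coord s → ℝ
  | none => if cnt y = 0 then 1 else 0
  | some (j, k) => (if cnt y = (k : ℕ) + 1 then 1 else 0) * indR (y j)

/-- The vector `b_yh ∈ ℝ^{s²+1}`. -/
noncomputable def bVec (s : ℕ) (β : ℝ) (yh : Fin s → Bool) : Coord s → ℝ
  | none => if cnt yh = 0 then -1 else 0
  | some (j, k) => -((1 + β ^ 2) * indR (yh j)) / (β ^ 2 * ((k : ℕ) + 1) + (cnt yh : ℝ))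


theorem sum_indR_sq {s : ℕ} (y : Fin s → Bool) : ∑ j, indR (y j) ^ 2 = (cnt y : ℝ) := by
  simp [indR, cnt]

theorem sum_bVec_sq (s : ℕ) (β : ℝ) (y : Fin s → Bool) :
    ∑ c : Coord s, bVec s β y c ^ 2 = (if cnt y = 0 then 1 else 0) +
      ∑ k : Fin s, (cnt y : ℝ) * ((1 + β ^ 2) / (β ^ 2 * ((k : ℕ) + 1) + cnt y)) ^ 2 := by
  rw [Fintype.sum_option, Fintype.sum_prod_type_right]
  congr 1
  · by_cases h : cnt y = 0 <;> simp [bVec, h]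
  · refine Finset.sum_congr rfl fun k _ => ?_
    rw [← sum_indR_sq y, Finset.sum_mul, sum_indR_sq y]
    refine Finset.sum_congr rfl fun j _ => ?_
    simp only [bVec]
    ring

theorem mul_div_sq_le {β m k : ℝ} (hβ : 0 < β) (hm : 0 < m) (hk : 0 < k) :
    m * ((1 + β ^ 2) / (β ^ 2 * k + m)) ^ 2 ≤ ((1 + β ^ 2) / (2 * β)) ^ 2 * k⁻¹ := by
  have h : 4 * β ^ 2 * k * m ≤ (β ^ 2 * k + m) ^ 2 := by
    nlinarith [sq_nonneg (β ^ 2 * k - m)]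
  rw [div_pow, div_pow, ← div_eq_mul_inv, div_div, mul_div_assoc', div_le_div_iff₀ (by positivity)
    (by positivity)]
  nlinarith [mul_le_mul_of_nonneg_left h (sq_nonneg (1 + β ^ 2))]

theorem sum_fin_inv_le_log_add_one (s : ℕ) :
    ∑ k : Fin s, ((k : ℕ) + 1 : ℝ)⁻¹ ≤ Real.log s + 1 := by
  have h := harmonic_le_one_add_log s
  rw [Fin.sum_univ_eq_sum_range (fun k : ℕ => ((k : ℝ) + 1)⁻¹) s]
  simp only [harmonic] at h
  push_cast at h
  linarith

theorem sum_bVec_sq_le (s : ℕ) {β : ℝ} (hβ : 0 < β) (y : Fin s → Bool) :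
    ∑ c : Coord s, bVec s β y c ^ 2 ≤ ((1 + β ^ 2) / (2 * β)) ^ 2 * (Real.log s + 1) := by
  rw [sum_bVec_sq]
  by_cases h : cnt y = 0
  · have h1 : 1 ≤ (1 + β ^ 2) / (2 * β) := by
      rw [one_le_div (by positivity)]
      nlinarith [sq_nonneg (β - 1)]
    have h2 : 0 ≤ Real.log s := Real.log_natCast_nonneg s
    simp only [h, if_true, Nat.cast_zero, zero_mul, Finset.sum_const_zero, add_zero]
    exact one_le_mul_of_one_le_of_one_le (one_le_pow₀ h1) (by linarith)
  · have hm : (0 : ℝ) < cnt y := by exact_mod_cast Nat.pos_of_ne_zero h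
    rw [if_neg h, zero_add]
    calc _ ≤ ∑ k : Fin s, ((1 + β ^ 2) / (2 * β)) ^ 2 * ((k : ℕ) + 1 : ℝ)⁻¹ :=
          Finset.sum_le_sum fun k _ => mul_div_sq_le hβ hm (by positivity)
      _ ≤ _ := by
          rw [← Finset.mul_sum]
          exact mul_le_mul_of_nonneg_left (sum_fin_inv_le_log_add_one s) (sq_nonneg _)

/-- the maximum over `yh ∈ {0,1}^s` of the Euclidean norm `‖b_yh‖₂`
is at most `((1+β²)/(2β))·√(ln s + 1)`. -/
theorem max_bVec_norm_le (s : ℕ) (hs : 1 ≤ s) (β : ℝ) (hβ : 0 < β) :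
    (⨆ yh : Fin s → Bool, Real.sqrt (∑ c : Coord s, (bVec s β yh c) ^ 2))
      ≤ (1 + β ^ 2) / (2 * β) * Real.sqrt (Real.log s + 1) := by
  refine ciSup_le fun y => ?_
  rw [← Real.sqrt_sq (show 0 ≤ (1 + β ^ 2) / (2 * β) by positivity),
    ← Real.sqrt_mul (sq_nonneg _)]
  exact Real.sqrt_le_sqrt (sum_bVec_sq_le s hβ y)
end

section
/- (Correctness of the O(s³) decode procedure) Let s ≥ 1, β > 0, and v = (v_0, (v_{jk})_{j,k=1}^s) ∈ ℝ^{s²+1}. For each l ∈ [s], let T_{jl} = −(1+β²) Σ_{k=1}^s v_{jk}/(β²k + l), let ŷ^{l,*} ∈ {0,1}^s be a vector with ones exactly at indices of l smallest values among {T_{jl} : j ∈ [s]}, and let z*_l = Σ_{j=1}^s ŷ^{l,*}_j T_{jl}. Then any ŷ* ∈ argmin over {0, ŷ^{1,*}, …, ŷ^{s,*}} of the value (−v_0 for ŷ = 0, and z*_{‖ŷ‖₁} otherwise) is a global minimizer over all ŷ ∈ {0,1}^s of the decode objective b_{ŷ,0} v_0 + Σ_{j=1}^s Σ_{k=1}^s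 b_{ŷ,jk} v_{jk}. -/
open Finset

/-- A set of `n` indices carrying the smallest values of `f` minimizes the sum of `f` among the
sets with `n` elements. -/
theorem sum_le_sum_of_card_eq_of_forall_le {ι : Type*} [DecidableEq ι] {A B : Finset ι}
    {f : ι → ℝ} (hcard : A.card = B.card) (hle : ∀ a ∈ A, ∀ b ∉ A, f a ≤ f b) :
    ∑ a ∈ A, f a ≤ ∑ b ∈ B, f b := by
  have hc : (A \ B).card = (B \ A).card := Finset.card_sdiff_comm hcard
  suffices h : ∑ a ∈ A \ B, f a ≤ ∑ b ∈ B \ A, f b by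
    rw [← Finset.sum_inter_add_sum_sdiff A B f, ← Finset.sum_inter_add_sum_sdiff B A f,
      Finset.inter_comm B A]
    gcongr
  rcases (A \ B).eq_empty_or_nonempty with h | h
  · rw [h, Finset.card_empty] at hc
    rw [h, Finset.card_eq_zero.mp hc.symm]
  · obtain ⟨m, hm, hmax⟩ := Finset.exists_max_image (A \ B) f h
    calc ∑ a ∈ A \ B, f a ≤ (A \ B).card • f m := Finset.sum_le_card_nsmul _ _ _ hmax
      _ = (B \ A).card • f m := by rw [hc]
      _ ≤ ∑ b ∈ B \ A, f b := Finset.card_nsmul_le_sum _ _ _ fun b hb =>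
          hle m (Finset.mem_sdiff.mp hm).1 b (Finset.mem_sdiff.mp hb).2

theorem sum_indR_mul {s : ℕ} (y : Fin s → Bool) (f : Fin s → ℝ) :
    ∑ j, indR (y j) * f j = ∑ j ∈ univ.filter (fun j => y j = true), f j := by
  simp [indR, Finset.sum_filter]

theorem indR_eq_zero_of_cnt_eq_zero {s : ℕ} {y : Fin s → Bool} (hy : cnt y = 0) (j : Fin s) :
    indR (y j) = 0 := by
  simp only [cnt, Finset.card_eq_zero, Finset.filter_eq_empty_iff] at hy
  simp [indR, hy (Finset.mem_univ j)]

theorem cnt_le {s : ℕ} (y : Fin s → Bool) : cnt y ≤ s := by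
  simpa [cnt] using Finset.card_filter_le (univ : Finset (Fin s)) (fun j => y j = true)

theorem decodeObjective_of_cnt_eq_zero {s : ℕ} (β : ℝ) (v : Coord s → ℝ) {y : Fin s → Bool}
    (hy : cnt y = 0) :
    bVec s β y none * v none + ∑ j : Fin s, ∑ k : Fin s, bVec s β y (some (j, k)) * v (some (j, k))
      = -(v none) := by
  simp [bVec, hy, indR_eq_zero_of_cnt_eq_zero hy]

theorem decodeObjective_of_cnt_eq_succ {s : ℕ} (β : ℝ) (v : Coord s → ℝ) {y : Fin s → Bool}
    {n : ℕ} (hy : cnt y = n + 1) :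
    bVec s β y none * v none + ∑ j : Fin s, ∑ k : Fin s, bVec s β y (some (j, k)) * v (some (j, k))
      = ∑ j, indR (y j) * (-(1 + β ^ 2) *
          ∑ k : Fin s, v (some (j, k)) / (β ^ 2 * ((k : ℕ) + 1) + ((n : ℕ) + 1))) := by
  simp only [bVec, hy, Nat.succ_ne_zero, if_false, zero_mul, zero_add, Finset.mul_sum]
  refine Finset.sum_congr rfl fun j _ => Finset.sum_congr rfl fun k _ => ?_
  push_cast
  ring

/-- correctness of the O(s³) decode procedure: with
`T_{jl} = −(1+β²) Σ_k v_{jk}/(β²k + l)` (here the column index `l : Fin s` encodes the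
value `l+1 ∈ [s]`), let `ystar l ∈ {0,1}^s` have ones exactly at indices of `l+1` smallest
values among `{T_{jl} : j ∈ [s]}`, and let `z l = Σ_j (ystar l)_j T_{jl}`. Then any candidate
(indexed by `i : Option (Fin s)`, with `none` standing for the zero labeling with value `−v₀`
and `some l` standing for `ystar l` with value `z l`) whose value is minimal among all
candidate values is a global minimizer of the decode objective
`b_{yh,0} v₀ + Σ_{j,k} b_{yh,jk} v_{jk}` over all `yh ∈ {0,1}^s`. -/
theorem decode_procedure_correct (s : ℕ) (hs : 1 ≤ s) (β : ℝ) (hβ : 0 < β)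
    (v : Coord s → ℝ) (T : Fin s → Fin s → ℝ)
    (hT : ∀ j l : Fin s,
      T j l = -(1 + β ^ 2) *
        ∑ k : Fin s, v (some (j, k)) / (β ^ 2 * ((k : ℕ) + 1) + ((l : ℕ) + 1)))
    (ystar : Fin s → Fin s → Bool)
    (hcard : ∀ l, cnt (ystar l) = (l : ℕ) + 1)
    (hsmall : ∀ l j j', ystar l j = true → ystar l j' = false → T j l ≤ T j' l)
    (z : Fin s → ℝ) (hz : ∀ l, z l = ∑ j, indR (ystar l j) * T j l)
    (i : Option (Fin s))
    (hi : ∀ i' : Option (Fin s), i.elim (-(v none)) z ≤ i'.elim (-(v none)) z) :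
    ∀ yh : Fin s → Bool,
      bVec s β (i.elim (fun _ => false) ystar) none * v none
          + ∑ j : Fin s, ∑ k : Fin s,
              bVec s β (i.elim (fun _ => false) ystar) (some (j, k)) * v (some (j, k))
        ≤ bVec s β yh none * v none
            + ∑ j : Fin s, ∑ k : Fin s, bVec s β yh (some (j, k)) * v (some (j, k)) := by
  intro yh
  have hstar : bVec s β (i.elim (fun _ => false) ystar) none * v none
      + ∑ j : Fin s, ∑ k : Fin s,
          bVec s β (i.elim (fun _ => false) ystar) (some (j, k)) * v (some (j, k))
      = i.elim (-(v none)) z := by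
    cases i with
    | none => exact decodeObjective_of_cnt_eq_zero β v (by simp [cnt])
    | some l =>
      simp only [Option.elim_some]
      rw [decodeObjective_of_cnt_eq_succ β v (hcard l), hz]
      simp only [hT]
  rw [hstar]
  rcases hn : cnt yh with _ | n
  · rw [decodeObjective_of_cnt_eq_zero β v hn]
    exact hi none
  · let l : Fin s := ⟨n, by have := cnt_le yh; omega⟩
    have hobj := decodeObjective_of_cnt_eq_succ β v hn
    rw [hobj]
    calc i.elim (-(v none)) z ≤ z l := hi (some l)
      _ = ∑ j ∈ univ.filter (fun j => ystar l j = true), T j l := by rw [hz, sum_indR_mul]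
      _ ≤ ∑ j ∈ univ.filter (fun j => yh j = true), T j l := by
          refine sum_le_sum_of_card_eq_of_forall_le ((hcard l).trans hn.symm) fun a ha b hb => ?_
          exact hsmall l a b (by simpa using ha) (by simpa using hb)
      _ = _ := by
          rw [← sum_indR_mul]
          simp only [hT, l]
end
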